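/- Let a ∈ (0,∞), α ∈ (−∞,2], and let q : (a,∞) → ℝ be measurable and locally integrable. Suppose there exist C ∈ (0,∞), N ∈ ℕ, and R ∈ (a,∞) such that the iterated logarithms Ln₁(x),…,Ln_N(x) are defined and positive on [R,∞) and q(x) ≥ −C·x^(2−α)·Π_{k=1}^{N} [Ln_k(x)]² for a.e. x ∈ [R,∞). Then the differential expression τ_α = −(d/dx) x^α (d/dx) + q(x) is in the limit point case at x = ∞. -/

import Mathlib

noncomputable section

open MeasureTheory Set
open scoped ENNReal NNReal

/-- Iterated logarithms at infinity: `LnIter 1 x = ln x`, `LnIter (j+1) x = ln (LnIter j x)`. -/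
def LnIter : ℕ → ℝ → ℝ
  | 0, x => x
  | j + 1, x => Real.log (LnIter j x)

/-- `(u, v)` is a (complex-valued) solution of `τ_α u = z u` on `(a, ∞)`, where
`τ_α = -(d/dx) x^α (d/dx) + q(x)` and `v` plays the role of the quasi-derivative `x^α u'`. -/
def IsSolutionC (a : ℝ) (α : ℝ) (q : ℝ → ℝ) (z : ℂ) (u v : ℝ → ℂ) : Prop :=
  ∀ x ∈ Ioi a, ∀ x₀ ∈ Ioi a,
    (u x = u x₀ + ∫ t in x₀..x, ((t ^ (-α) : ℝ) : ℂ) * v t) ∧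
    (v x = v x₀ + ∫ t in x₀..x, ((q t : ℂ) - z) * u t)

/-- `τ_α` is in the limit point case at `x = ∞`: for every `z ∈ ℂ` there is a solution
of `τ_α u = z u` with `∫_c^∞ |u|² dx = ∞` for some `c ∈ (a, ∞)`. -/
def LimitPointAtInfinity (a : ℝ) (α : ℝ) (q : ℝ → ℝ) : Prop :=
  ∀ z : ℂ, ∃ u v : ℝ → ℂ, IsSolutionC a α q z u v ∧
    ∃ c ∈ Ioi a, (∫⁻ x in Ioi c, (‖u x‖₊ : ℝ≥0∞) ^ 2) = ⊤

/-- Absolute continuity passes to functions whose increments are dominated by those of an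
absolutely continuous function. -/
theorem absolutelyContinuousOnInterval_of_dist_le {X Y : Type*} [PseudoMetricSpace X]
    [PseudoMetricSpace Y] {f : ℝ → X} {g : ℝ → Y} {a b : ℝ}
    (hg : AbsolutelyContinuousOnInterval g a b)
    (h : ∀ x ∈ uIcc a b, ∀ y ∈ uIcc a b, dist (f x) (f y) ≤ dist (g x) (g y)) :
    AbsolutelyContinuousOnInterval f a b := by
  rw [absolutelyContinuousOnInterval_iff] at hg ⊢
  intro ε hε
  obtain ⟨δ, hδ, H⟩ := hg ε hε
  refine ⟨δ, hδ, fun E hE hlt => (Finset.sum_le_sum fun i hi => ?_).trans_lt (H E hE hlt)⟩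
  exact h _ (hE.1 i hi).1 _ (hE.1 i hi).2

/-- The primitive of a Banach-valued integrable function is absolutely continuous. -/
theorem absolutelyContinuousOnInterval_primitive {E : Type*} [NormedAddCommGroup E]
    [NormedSpace ℝ E] {f : ℝ → E} {a b c : ℝ} (hf : IntervalIntegrable f volume a b)
    (hc : c ∈ uIcc a b) :
    AbsolutelyContinuousOnInterval (fun x => ∫ t in c..x, f t) a b := by
  refine absolutelyContinuousOnInterval_of_dist_le
    (hf.norm.absolutelyContinuousOnInterval_intervalIntegral hc) fun x hx y hy => ?_
  have hI : ∀ {w}, w ∈ uIcc a b → IntervalIntegrable f volume c w := fun hw =>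
    hf.mono_set (uIcc_subset_uIcc hc hw)
  rw [dist_eq_norm, dist_eq_norm, intervalIntegral.integral_interval_sub_left (hI hx) (hI hy),
    intervalIntegral.integral_interval_sub_left (hI hx).norm (hI hy).norm]
  exact intervalIntegral.norm_integral_le_abs_integral_norm

/-- Powers of a primitive integrate like powers of a smooth function. -/
theorem integral_mul_primitive_pow {k : ℝ → ℝ} {c x : ℝ} (hk : IntervalIntegrable k volume c x)
    (n : ℕ) :
    ∫ t in c..x, k t * (∫ s in c..t, k s) ^ n = (∫ s in c..x, k s) ^ (n + 1) / (n + 1) := by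
  have hac : ∀ m : ℕ, AbsolutelyContinuousOnInterval (fun t => (∫ s in c..t, k s) ^ (m + 1)) c x := by
    have h0 := absolutelyContinuousOnInterval_primitive hk left_mem_uIcc
    intro m
    induction m with
    | zero => simpa using h0
    | succ m ih => simpa only [pow_succ _ (m + 1)] using ih.fun_mul h0
  have h := (hac n).integral_deriv_eq_sub
  have hcongr : ∫ t in c..x, deriv (fun t => (∫ s in c..t, k s) ^ (n + 1)) t
      = ∫ t in c..x, (n + 1) * (k t * (∫ s in c..t, k s) ^ n) := by
    refine intervalIntegral.integral_congr_ae ?_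
    filter_upwards [hk.ae_hasDerivAt_integral] with t ht hmem
    rw [((ht (uIoc_subset_uIcc hmem) c left_mem_uIcc).fun_pow (n + 1)).deriv]
    push_cast
    ring
  rw [hcongr, intervalIntegral.integral_const_mul] at h
  have hn : (n : ℝ) + 1 ≠ 0 := by positivity
  rw [eq_div_iff hn, mul_comm, h]
  simp

/-- Global solutions of linear Volterra equations with locally integrable coefficients. -/
theorem exists_eq_add_integral_clm_apply {E : Type*} [NormedAddCommGroup E] [NormedSpace ℝ E]
    [CompleteSpace E] {s : Set ℝ} [hs : OrdConnected s] {c : ℝ} (hc : c ∈ s)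
    {A : ℝ → E →L[ℝ] E} (hA : ∀ x ∈ s, IntervalIntegrable A volume c x) (y₀ : E) :
    ∃ Y : ℝ → E, ∀ x ∈ s, IntervalIntegrable (fun t => A t (Y t)) volume c x ∧
      Y x = y₀ + ∫ t in c..x, A t (Y t) := by
  have happ : ∀ x ∈ s, ∀ Z : ℝ → E, ContinuousOn Z (uIcc c x) →
      IntervalIntegrable (fun t => A t (Z t)) volume c x := by
    intro x hx Z hZ
    obtain ⟨M, hM⟩ := isCompact_uIcc.exists_bound_of_continuousOn hZ
    have h1 := intervalIntegrable_iff.1 (hA x hx)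
    refine intervalIntegrable_iff.2 ((h1.norm.mul_const M).mono' ?_ ?_)
    · exact (ContinuousLinearMap.id ℝ (E →L[ℝ] E)).aestronglyMeasurable_comp₂
        h1.aestronglyMeasurable
        ((hZ.mono uIoc_subset_uIcc).aestronglyMeasurable measurableSet_uIoc)
    · refine (ae_restrict_iff' measurableSet_uIoc).2 (ae_of_all _ fun t ht => ?_)
      exact (A t).le_opNorm_of_le (hM t (uIoc_subset_uIcc ht))
  let Y : ℕ → ℝ → E := fun n => Nat.rec (fun _ => y₀) (fun _ Z x => ∫ t in c..x, A t (Z t)) n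
  have hY1 : ∀ n x, Y (n + 1) x = ∫ t in c..x, A t (Y n t) := fun _ _ => rfl
  have hsub : ∀ {x t}, x ∈ s → t ∈ uIcc c x → t ∈ s := fun hx ht => hs.uIcc_subset hc hx ht
  have hcont : ∀ n, ∀ x ∈ s, ContinuousOn (Y n) (uIcc c x) := by
    intro n
    induction n with
    | zero => exact fun x _ => continuousOn_const
    | succ n ih =>
      intro x hx
      change ContinuousOn (fun w => ∫ t in c..w, A t (Y n t)) _
      exact intervalIntegral.continuousOn_primitive_interval' (happ x hx _ (ih x hx)) left_mem_uIcc
  have hbound : ∀ n, ∀ x ∈ s,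
      ‖Y n x‖ ≤ ‖y₀‖ * (|∫ t in c..x, ‖A t‖| ^ n / n.factorial) := by
    intro n
    induction n with
    | zero => intro x _; simp [Y]
    | succ n ih =>
      intro x hx
      have hk := (hA x hx).norm
      have hΦc : ContinuousOn (fun t => |∫ s in c..t, ‖A s‖|) (uIcc c x) :=
        (intervalIntegral.continuousOn_primitive_interval' hk left_mem_uIcc).abs
      have h1 : ‖Y (n + 1) x‖ ≤
          |∫ t in c..x, ‖A t‖ * (‖y₀‖ * (|∫ s in c..t, ‖A s‖| ^ n / n.factorial))| := by
        rw [hY1]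
        refine intervalIntegral.norm_integral_le_abs_of_norm_le ?_ ?_
        · refine (ae_restrict_iff' measurableSet_uIoc).2 (ae_of_all _ fun t ht => ?_)
          exact (A t).le_opNorm_of_le (ih t (hsub hx (uIoc_subset_uIcc ht)))
        · exact hk.mul_continuousOn (((hΦc.pow n).div_const _).const_mul _)
      have h2 : |∫ t in c..x, ‖A t‖ * |∫ s in c..t, ‖A s‖| ^ n|
          = |∫ t in c..x, ‖A t‖ * (∫ s in c..t, ‖A s‖) ^ n| := by
        rcases le_total c x with hcx | hxc
        · congr 1
          refine intervalIntegral.integral_congr fun t ht => ?_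
          rw [uIcc_of_le hcx] at ht
          rw [abs_of_nonneg (intervalIntegral.integral_nonneg ht.1 fun _ _ => norm_nonneg _)]
        · have : ∫ t in c..x, ‖A t‖ * |∫ s in c..t, ‖A s‖| ^ n
              = ∫ t in c..x, (-1) ^ n * (‖A t‖ * (∫ s in c..t, ‖A s‖) ^ n) := by
            refine intervalIntegral.integral_congr fun t ht => ?_
            rw [uIcc_of_ge hxc] at ht
            have h0 : ∫ s in c..t, ‖A s‖ ≤ 0 := by
              rw [intervalIntegral.integral_symm]
              exact neg_nonpos.2 (intervalIntegral.integral_nonneg ht.2 fun _ _ => norm_nonneg _)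
            rw [abs_of_nonpos h0, neg_pow]
            ring
          rw [this, intervalIntegral.integral_const_mul, abs_mul]
          simp
      refine h1.trans (le_of_eq ?_)
      have h3 : ∀ t, ‖A t‖ * (‖y₀‖ * (|∫ s in c..t, ‖A s‖| ^ n / n.factorial))
          = ‖y₀‖ / n.factorial * (‖A t‖ * |∫ s in c..t, ‖A s‖| ^ n) := fun t => by ring
      simp_rw [h3]
      rw [intervalIntegral.integral_const_mul, abs_mul, h2, integral_mul_primitive_pow hk,
        abs_of_nonneg (by positivity : 0 ≤ ‖y₀‖ / n.factorial), abs_div, abs_pow,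
        abs_of_pos (by positivity : (0 : ℝ) < n + 1), Nat.factorial_succ]
      push_cast
      field_simp
  have hunif : ∀ x ∈ s, ∀ t ∈ uIcc c x, ∀ n,
      ‖Y n t‖ ≤ ‖y₀‖ * (|∫ r in c..x, ‖A r‖| ^ n / n.factorial) := by
    intro x hx t ht n
    refine (hbound n t (hsub hx ht)).trans ?_
    have hle : |∫ r in c..t, ‖A r‖| ≤ |∫ r in c..x, ‖A r‖| := intervalIntegral.abs_integral_mono_interval (uIoc_subset_uIoc_of_uIcc_subset_uIcc
      (uIcc_subset_uIcc left_mem_uIcc ht)) (ae_of_all _ fun _ => norm_nonneg _) (hA x hx).norm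
    gcongr ‖y₀‖ * (?_ ^ n / _)
  have hsum : ∀ B : ℝ, Summable fun n : ℕ => ‖y₀‖ * (B ^ n / n.factorial) := fun B =>
    (Real.summable_pow_div_factorial B).mul_left _
  have hYs : ∀ x ∈ s, Summable fun n => Y n x := fun x hx =>
    (hsum _).of_norm_bounded (hbound · x hx)
  have hYc : ∀ x ∈ s, ContinuousOn (fun t => ∑' n, Y n t) (uIcc c x) := fun x hx =>
    continuousOn_tsum (fun n => hcont n x hx) (hsum _) fun n t ht => hunif x hx t ht n
  refine ⟨fun t => ∑' n, Y n t, fun x hx => ⟨happ x hx _ (hYc x hx), ?_⟩⟩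
  have hlim : HasSum (fun n => ∫ t in c..x, A t (Y n t)) (∫ t in c..x, A t (∑' n, Y n t)) := by
    refine intervalIntegral.hasSum_integral_of_dominated_convergence
      (fun n t => ‖A t‖ * (‖y₀‖ * (|∫ r in c..x, ‖A r‖| ^ n / n.factorial))) ?_ ?_ ?_ ?_ ?_
    · exact fun n => (intervalIntegrable_iff.1 (happ x hx _ (hcont n x hx))).aestronglyMeasurable
    · exact fun n => ae_of_all _ fun t ht =>
        (A t).le_opNorm_of_le (hunif x hx t (uIoc_subset_uIcc ht) n)
    · exact ae_of_all _ fun t _ => (hsum _).mul_left _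
    · simp_rw [tsum_mul_left]
      exact (hA x hx).norm.mul_const _
    · exact ae_of_all _ fun t ht =>
        (A t).hasSum (hYs t (hsub hx (uIoc_subset_uIcc ht))).hasSum
  rw [← hlim.tsum_eq]
  exact (hYs x hx).tsum_eq_zero_add

/-- A function which on `(a, ∞)` is a primitive of a locally integrable function is absolutely
continuous and almost everywhere differentiable with the expected derivative. -/
theorem ac_and_ae_hasDerivAt_of_eq_primitive {f f' : ℝ → ℂ} {a c : ℝ} (hc : a < c)
    (hint : ∀ x ∈ Ioi a, IntervalIntegrable f' volume c x)
    (hf : ∀ x ∈ Ioi a, f x = f c + ∫ t in c..x, f' t) :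
    (∀ x ≥ c, AbsolutelyContinuousOnInterval f c x) ∧
      ∀ᵐ t, c < t → HasDerivAt f (f' t) t := by
  refine ⟨fun x hx => ?_, ?_⟩
  · refine absolutelyContinuousOnInterval_of_dist_le
      (absolutelyContinuousOnInterval_primitive (hint x (hc.trans_le hx)) left_mem_uIcc)
      fun y hy w hw => ?_
    rw [uIcc_of_le hx] at hy hw
    rw [hf y (hc.trans_le hy.1), hf w (hc.trans_le hw.1), dist_add_left]
  · have h : ∀ n : ℕ, ∀ᵐ t, t ∈ uIcc c (c + n) →
        ∀ b ∈ uIcc c (c + n), HasDerivAt (fun x => ∫ t in b..x, f' t) (f' t) t := fun n =>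
      (hint (c + n) (hc.trans_le (by simp))).ae_hasDerivAt_integral
    filter_upwards [ae_all_iff.2 h] with t ht hct
    obtain ⟨n, hn⟩ := exists_nat_ge (t - c)
    have h1 := ht n (by rw [uIcc_of_le (by simp)]; exact ⟨hct.le, by linarith⟩) c left_mem_uIcc
    refine (h1.const_add (f c)).congr_of_eventuallyEq ?_
    filter_upwards [Ioi_mem_nhds (hc.trans hct)] with x hx using hf x hx

/-- Solutions of the first order system with prescribed initial values at `c`. -/
theorem exists_isSolutionC {a α : ℝ} (ha : 0 < a) {q : ℝ → ℝ}
    (hq : LocallyIntegrableOn q (Ioi a)) (z : ℂ) {c : ℝ} (hc : a < c) (u₀ v₀ : ℂ) :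
    ∃ u v : ℝ → ℂ, IsSolutionC a α q z u v ∧ u c = u₀ ∧ v c = v₀ ∧
      (∀ x ≥ c, AbsolutelyContinuousOnInterval u c x) ∧
      (∀ x ≥ c, AbsolutelyContinuousOnInterval v c x) ∧
      (∀ᵐ t, c < t → HasDerivAt u (((t ^ (-α) : ℝ) : ℂ) * v t) t) ∧
      ∀ᵐ t, c < t → HasDerivAt v (((q t : ℂ) - z) * u t) t := by
  let L₁ : ℂ × ℂ →L[ℝ] ℂ × ℂ :=
    (ContinuousLinearMap.inl ℝ ℂ ℂ).comp (ContinuousLinearMap.snd ℝ ℂ ℂ)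
  let L₂ : ℂ →L[ℝ] ℂ × ℂ →L[ℝ] ℂ × ℂ :=
    ((ContinuousLinearMap.compL ℝ (ℂ × ℂ) ℂ (ℂ × ℂ)) (ContinuousLinearMap.inr ℝ ℂ ℂ)).comp
      (((ContinuousLinearMap.compL ℝ (ℂ × ℂ) ℂ ℂ).flip (ContinuousLinearMap.fst ℝ ℂ ℂ)).comp
        (ContinuousLinearMap.mul ℝ ℂ))
  let A : ℝ → ℂ × ℂ →L[ℝ] ℂ × ℂ := fun t => (t ^ (-α)) • L₁ + L₂ ((q t : ℂ) - z)
  have hAapp : ∀ t y, A t y = (((t ^ (-α) : ℝ) : ℂ) * y.2, ((q t : ℂ) - z) * y.1) := by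
    intro t y
    simp [A, L₁, L₂, sub_mul]
  have hA : ∀ x ∈ Ioi a, IntervalIntegrable A volume c x := by
    intro x hx
    have hsub : uIcc c x ⊆ Ioi a := ordConnected_Ioi.uIcc_subset hc hx
    have hp : IntervalIntegrable (fun t : ℝ => t ^ (-α)) volume c x := by
      refine ContinuousOn.intervalIntegrable fun t ht => ?_
      exact (Real.continuousAt_rpow_const _ _
        (Or.inl (ha.trans (hsub ht)).ne')).continuousWithinAt
    have hqi : IntegrableOn (fun t => (q t : ℂ) - z) (uIoc c x) := by
      have h := (hq.integrableOn_compact_subset hsub isCompact_uIcc).mono_set uIoc_subset_uIcc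
      exact h.ofReal.sub (integrableOn_const (by simp) (by simp))
    rw [intervalIntegrable_iff] at hp ⊢
    exact (hp.smul_const L₁).add (L₂.integrable_comp hqi)
  obtain ⟨Y, hY⟩ := exists_eq_add_integral_clm_apply (s := Ioi a) (c := c) hc hA (u₀, v₀)
  have hYc : Y c = (u₀, v₀) := by simpa using (hY c hc).2
  have hi1 : ∀ x ∈ Ioi a,
      IntervalIntegrable (fun t => ((t ^ (-α) : ℝ) : ℂ) * (Y t).2) volume c x := by
    intro x hx
    have h := (hY x hx).1
    rw [intervalIntegrable_iff] at h ⊢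
    simpa [hAapp, IntegrableOn] using (ContinuousLinearMap.fst ℝ ℂ ℂ).integrable_comp h
  have hi2 : ∀ x ∈ Ioi a,
      IntervalIntegrable (fun t => ((q t : ℂ) - z) * (Y t).1) volume c x := by
    intro x hx
    have h := (hY x hx).1
    rw [intervalIntegrable_iff] at h ⊢
    simpa [hAapp, IntegrableOn] using (ContinuousLinearMap.snd ℝ ℂ ℂ).integrable_comp h
  have he1 : ∀ x ∈ Ioi a, (Y x).1 = (Y c).1 + ∫ t in c..x, ((t ^ (-α) : ℝ) : ℂ) * (Y t).2 := by
    intro x hx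
    obtain ⟨h, h'⟩ := hY x hx
    have := (ContinuousLinearMap.fst ℝ ℂ ℂ).intervalIntegral_comp_comm h
    simp only [hAapp, ContinuousLinearMap.coe_fst'] at this
    rw [this, hYc]
    conv_lhs => rw [h']
    simp [hAapp]
  have he2 : ∀ x ∈ Ioi a, (Y x).2 = (Y c).2 + ∫ t in c..x, ((q t : ℂ) - z) * (Y t).1 := by
    intro x hx
    obtain ⟨h, h'⟩ := hY x hx
    have := (ContinuousLinearMap.snd ℝ ℂ ℂ).intervalIntegral_comp_comm h
    simp only [hAapp, ContinuousLinearMap.coe_snd'] at this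
    rw [this, hYc]
    conv_lhs => rw [h']
    simp [hAapp]
  obtain ⟨hu, hu'⟩ := ac_and_ae_hasDerivAt_of_eq_primitive (f := fun x => (Y x).1) hc hi1 he1
  obtain ⟨hv, hv'⟩ := ac_and_ae_hasDerivAt_of_eq_primitive (f := fun x => (Y x).2) hc hi2 he2
  refine ⟨fun x => (Y x).1, fun x => (Y x).2, fun x hx y hy => ⟨?_, ?_⟩, by simp [hYc],
    by simp [hYc], hu, hv, hu', hv'⟩
  · simp only
    rw [he1 x hx, he1 y hy, ← intervalIntegral.integral_interval_sub_left (hi1 x hx) (hi1 y hy)]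
    ring
  · simp only
    rw [he2 x hx, he2 y hy, ← intervalIntegral.integral_interval_sub_left (hi2 x hx) (hi2 y hy)]
    ring

/-- A function whose derivative is bounded by a continuous function is absolutely continuous. -/
theorem absolutelyContinuousOnInterval_of_abs_hasDerivAt_le {g g' b : ℝ → ℝ} {c x : ℝ}
    (hcx : c ≤ x) (hg : ∀ t ≥ c, HasDerivAt g (g' t) t) (hb : ContinuousOn b (Ici c))
    (hle : ∀ t ≥ c, |g' t| ≤ b t) : AbsolutelyContinuousOnInterval g c x := by
  obtain ⟨M, hM⟩ := isCompact_Icc.exists_bound_of_continuousOn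
    (hb.mono (Icc_subset_Ici_self : Icc c x ⊆ Ici c))
  refine LipschitzOnWith.absolutelyContinuousOnInterval (K := M.toNNReal) ?_
  rw [uIcc_of_le hcx]
  refine (convex_Icc c x).lipschitzOnWith_of_nnnorm_hasDerivWithin_le
    (fun t ht => (hg t ht.1).hasDerivWithinAt) fun t ht => ?_
  rw [← NNReal.coe_le_coe, coe_nnnorm, Real.norm_eq_abs]
  exact (hle t ht.1).trans ((le_abs_self _).trans ((hM t ht).trans (Real.le_coe_toNNReal M)))

/-- The weighted bound on quasi-derivatives: here `σ = ‖u‖`, `τ = ‖v‖` and `e = Re (v * conj u)` for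
a square integrable solution `(u, v)`. -/
theorem exists_bound_integral_sq_mul_sq {c K C l : ℝ} {s q g g' σ τ e : ℝ → ℝ}
    (hs : ContinuousOn s (Ici c)) (hs0 : ∀ t ≥ c, 0 ≤ s t)
    (hg0 : ∀ t ≥ c, 0 ≤ g t) (hg1 : ∀ t ≥ c, g t ≤ 1)
    (hg : ∀ t ≥ c, HasDerivAt g (g' t) t) (hg' : ∀ t ≥ c, |g' t| ≤ K * s t)
    (hq : ∀ᵐ t, c ≤ t → -C ≤ g t ^ 2 * q t)
    (hσ : ∀ x ≥ c, AbsolutelyContinuousOnInterval (fun t => σ t ^ 2) c x)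
    (hτ : ∀ x ≥ c, ContinuousOn (fun t => τ t ^ 2) (uIcc c x))
    (hτ0 : ∀ t, 0 ≤ τ t)
    (he : ∀ x ≥ c, AbsolutelyContinuousOnInterval e c x)
    (heb : ∀ t, |e t| ≤ σ t * τ t)
    (hσ' : ∀ᵐ t, c < t → HasDerivAt (fun t => σ t ^ 2) (2 * s t ^ 2 * e t) t)
    (he' : ∀ᵐ t, c < t → HasDerivAt e (s t ^ 2 * τ t ^ 2 + (q t - l) * σ t ^ 2) t)
    {D : ℝ} (hD : ∀ x ≥ c, ∫ t in c..x, σ t ^ 2 ≤ D) :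
    ∃ B, ∀ x ≥ c, ∫ t in c..x, (g t * s t) ^ 2 * τ t ^ 2 ≤ B := by
  have hgAC : ∀ x ≥ c, AbsolutelyContinuousOnInterval g c x := fun x hx =>
    absolutelyContinuousOnInterval_of_abs_hasDerivAt_le hx hg (hs.const_mul K) hg'
  have hFAC : ∀ x ≥ c, AbsolutelyContinuousOnInterval (fun t => g t * g t * e t) c x :=
    fun x hx => ((hgAC x hx).fun_mul (hgAC x hx)).fun_mul (he x hx)
  have hHc : ∀ x ≥ c, ContinuousOn (fun t => (g t * s t) ^ 2 * τ t ^ 2) (uIcc c x) := by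
    intro x hx
    have hsub : uIcc c x ⊆ Ici c := by rw [uIcc_of_le hx]; exact Icc_subset_Ici_self
    exact (((hgAC x hx).continuousOn.mul (hs.mono hsub)).pow 2).mul (hτ x hx)
  have hHi : ∀ x ≥ c, IntervalIntegrable (fun t => (g t * s t) ^ 2 * τ t ^ 2) volume c x :=
    fun x hx => (hHc x hx).intervalIntegrable
  have hσi : ∀ x ≥ c, IntervalIntegrable (fun t => σ t ^ 2) volume c x :=
    fun x hx => (hσ x hx).continuousOn.intervalIntegrable
  set M : ℝ := 2 * K ^ 2 + |C| + |l| with hM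
  have hM0 : 0 ≤ M := by positivity
  have hF' : ∀ᵐ t, c < t → (1 / 2) * ((g t * s t) ^ 2 * τ t ^ 2) - M * σ t ^ 2 ≤
      deriv (fun t => g t * g t * e t) t := by
    filter_upwards [he', hq] with t ht hqt hct
    rw [(((hg t hct.le).fun_mul (hg t hct.le)).fun_mul (ht hct)).deriv]
    have h0 := hg0 t hct.le
    have h1 := hg1 t hct.le
    have h2 := hs0 t hct.le
    have hgb : |2 * g t * g' t * e t| ≤ 2 * g t * (K * s t) * (σ t * τ t) := by
      rw [abs_mul, abs_mul, abs_of_nonneg (by positivity : 0 ≤ 2 * g t)]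
      have hgt := hg' t hct.le
      have het := heb t
      have hK := (abs_nonneg _).trans hgt
      gcongr
    have h3 := neg_le_of_abs_le hgb
    have h4 : -|C| * σ t ^ 2 ≤ g t ^ 2 * q t * σ t ^ 2 :=
      mul_le_mul_of_nonneg_right ((neg_le_neg (le_abs_self C)).trans (hqt hct.le)) (sq_nonneg _)
    have h5 : g t ^ 2 * l * σ t ^ 2 ≤ |l| * σ t ^ 2 := by
      refine mul_le_mul_of_nonneg_right ?_ (sq_nonneg _)
      have : g t ^ 2 ≤ 1 := pow_le_one₀ h0 h1
      calc g t ^ 2 * l ≤ g t ^ 2 * |l| := by gcongr; exact le_abs_self l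
        _ ≤ 1 * |l| := by gcongr
        _ = |l| := one_mul _
    have h6 := sq_nonneg (g t * s t * τ t - 2 * K * σ t)
    rw [hM]
    nlinarith [h3, h4, h5, h6]
  have hF : ∀ x ≥ c, (1 / 2) * (∫ t in c..x, (g t * s t) ^ 2 * τ t ^ 2) - M * D
      ≤ g x * g x * e x - g c * g c * e c := by
    intro x hx
    rw [← (hFAC x hx).integral_deriv_eq_sub]
    calc _ ≤ (1 / 2) * (∫ t in c..x, (g t * s t) ^ 2 * τ t ^ 2)
          - M * ∫ t in c..x, σ t ^ 2 := by gcongr; exact hD x hx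
      _ = ∫ t in c..x, ((1 / 2) * ((g t * s t) ^ 2 * τ t ^ 2) - M * σ t ^ 2) := by
        rw [intervalIntegral.integral_sub ((hHi x hx).const_mul _) ((hσi x hx).const_mul _),
          intervalIntegral.integral_const_mul, intervalIntegral.integral_const_mul]
      _ ≤ _ := by
        refine intervalIntegral.integral_mono_ae_restrict hx
          (((hHi x hx).const_mul _).sub ((hσi x hx).const_mul _))
          (hFAC x hx).intervalIntegrable_deriv ?_
        rw [Filter.EventuallyLE, ← restrict_Ioc_eq_restrict_Icc,
          ae_restrict_iff' measurableSet_Ioc]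
        filter_upwards [hF'] with t ht hmem using ht hmem.1
  by_contra! hcon
  obtain ⟨x₀, hx₀, hbig⟩ := hcon (2 * (M * D + |g c * g c * e c|))
  have hpos : ∀ x ≥ x₀, 0 < e x := by
    intro x hx
    have hmono : ∫ t in c..x₀, (g t * s t) ^ 2 * τ t ^ 2
        ≤ ∫ t in c..x, (g t * s t) ^ 2 * τ t ^ 2 :=
      intervalIntegral.integral_mono_interval le_rfl hx₀ hx
        (ae_of_all _ fun t => by positivity) (hHi x (hx₀.le.trans hx))
    have h1 := hF x (hx₀.le.trans hx)
    have h2 := neg_abs_le (g c * g c * e c)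
    have h3 : 0 < g x * g x * e x := by linarith
    exact pos_of_mul_pos_right h3 (mul_self_nonneg _)
  have hmono : ∀ x ≥ x₀, σ x₀ ^ 2 ≤ σ x ^ 2 := by
    intro x hx
    have hac : AbsolutelyContinuousOnInterval (fun t => σ t ^ 2) x₀ x := by
      refine (hσ x (hx₀.le.trans hx)).mono ?_
      rw [uIcc_of_le hx, uIcc_of_le (hx₀.le.trans hx)]
      exact Icc_subset_Icc_left hx₀
    rw [← sub_nonneg, ← hac.integral_deriv_eq_sub]
    refine intervalIntegral.integral_nonneg_of_ae_restrict hx ?_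
    rw [Filter.EventuallyLE, ← restrict_Ioc_eq_restrict_Icc, ae_restrict_iff' measurableSet_Ioc]
    filter_upwards [hσ'] with t ht hmem
    rw [(ht (hx₀.trans_lt hmem.1)).deriv]
    have := hpos t hmem.1.le
    simp only [Pi.zero_apply]
    positivity
  have hσpos : 0 < σ x₀ ^ 2 := by
    have h1 := (hpos x₀ le_rfl).trans_le ((le_abs_self _).trans (heb x₀))
    have h2 : 0 < σ x₀ := pos_of_mul_pos_left h1 (hτ0 x₀)
    positivity
  have hlin : ∀ x ≥ x₀, (x - x₀) * σ x₀ ^ 2 ≤ D := by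
    intro x hx
    have hcx := hx₀.le.trans hx
    have hsub : uIcc x₀ x ⊆ uIcc c x := by
      rw [uIcc_of_le hx, uIcc_of_le hcx]
      exact Icc_subset_Icc_left hx₀
    calc (x - x₀) * σ x₀ ^ 2 = ∫ _ in x₀..x, σ x₀ ^ 2 := by simp
      _ ≤ ∫ t in x₀..x, σ t ^ 2 := by
        refine intervalIntegral.integral_mono_on hx (by simp) ((hσi x hcx).mono_set hsub)
          fun t ht => hmono t ht.1
      _ ≤ ∫ t in c..x, σ t ^ 2 :=
        intervalIntegral.integral_mono_interval hx₀ hx le_rfl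
          (ae_of_all _ fun t => sq_nonneg _) (hσi x hcx)
      _ ≤ D := hD x hcx
  have h := hlin (x₀ + (|D| + 1) / σ x₀ ^ 2) (by
    have : 0 < (|D| + 1) / σ x₀ ^ 2 := by positivity
    linarith)
  rw [add_sub_cancel_left, div_mul_cancel₀ _ hσpos.ne'] at h
  linarith [le_abs_self D]

theorem hasDerivAt_re_im {f : ℝ → ℂ} {f' : ℂ} {t : ℝ} (h : HasDerivAt f f' t) :
    HasDerivAt (fun t => (f t).re) f'.re t ∧ HasDerivAt (fun t => (f t).im) f'.im t :=
  ⟨Complex.reCLM.hasFDerivAt.comp_hasDerivAt t h, Complex.imCLM.hasFDerivAt.comp_hasDerivAt t h⟩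

theorem ac_re_im {f : ℝ → ℂ} {a b : ℝ} (h : AbsolutelyContinuousOnInterval f a b) :
    AbsolutelyContinuousOnInterval (fun t => (f t).re) a b ∧
      AbsolutelyContinuousOnInterval (fun t => (f t).im) a b := by
  constructor <;> refine absolutelyContinuousOnInterval_of_dist_le h fun x _ y _ => ?_
  · simpa [dist_eq_norm] using Complex.abs_re_le_norm (f x - f y)
  · simpa [dist_eq_norm] using Complex.abs_im_le_norm (f x - f y)

/-- The weighted bound on the quasi-derivative of a square integrable solution. -/
theorem exists_bound_integral_quasiDeriv {c K C D : ℝ} {s q g g' : ℝ → ℝ} {z : ℂ} {u v : ℝ → ℂ}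
    (hs : ContinuousOn s (Ici c)) (hs0 : ∀ t ≥ c, 0 ≤ s t)
    (hg0 : ∀ t ≥ c, 0 ≤ g t) (hg1 : ∀ t ≥ c, g t ≤ 1)
    (hg : ∀ t ≥ c, HasDerivAt g (g' t) t) (hg' : ∀ t ≥ c, |g' t| ≤ K * s t)
    (hq : ∀ᵐ t, c ≤ t → -C ≤ g t ^ 2 * q t)
    (hu : ∀ x ≥ c, AbsolutelyContinuousOnInterval u c x)
    (hv : ∀ x ≥ c, AbsolutelyContinuousOnInterval v c x)
    (hu' : ∀ᵐ t, c < t → HasDerivAt u (((s t ^ 2 : ℝ) : ℂ) * v t) t)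
    (hv' : ∀ᵐ t, c < t → HasDerivAt v (((q t : ℂ) - z) * u t) t)
    (hD : ∀ x ≥ c, ∫ t in c..x, ‖u t‖ ^ 2 ≤ D) :
    ∃ B, ∀ x ≥ c, ∫ t in c..x, (g t * s t) ^ 2 * ‖v t‖ ^ 2 ≤ B := by
  have hsq : ∀ w : ℂ, ‖w‖ ^ 2 = w.re * w.re + w.im * w.im := fun w => by
    rw [Complex.sq_norm, Complex.normSq_apply]
  refine exists_bound_integral_sq_mul_sq (l := z.re)
    (e := fun t => (u t).re * (v t).re + (u t).im * (v t).im)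
    hs hs0 hg0 hg1 hg hg' hq ?_ ?_ (fun t => norm_nonneg _) ?_ ?_ ?_ ?_ hD
  · intro x hx
    obtain ⟨h1, h2⟩ := ac_re_im (hu x hx)
    simpa only [hsq] using (h1.fun_mul h1).fun_add (h2.fun_mul h2)
  · exact fun x hx => (hv x hx).continuousOn.norm.pow 2
  · intro x hx
    obtain ⟨h1, h2⟩ := ac_re_im (hu x hx)
    obtain ⟨h3, h4⟩ := ac_re_im (hv x hx)
    exact (h1.fun_mul h3).fun_add (h2.fun_mul h4)
  · intro t
    have h := Complex.abs_re_le_norm (u t * (starRingEnd ℂ) (v t))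
    simpa using h
  · filter_upwards [hu'] with t ht hct
    obtain ⟨h1, h2⟩ := hasDerivAt_re_im (ht hct)
    simp only [hsq]
    refine ((h1.fun_mul h1).fun_add (h2.fun_mul h2)).congr_deriv ?_
    simp only [Complex.re_ofReal_mul, Complex.im_ofReal_mul]
    ring
  · filter_upwards [hu', hv'] with t ht ht' hct
    obtain ⟨h1, h2⟩ := hasDerivAt_re_im (ht hct)
    obtain ⟨h3, h4⟩ := hasDerivAt_re_im (ht' hct)
    refine ((h1.fun_mul h3).fun_add (h2.fun_mul h4)).congr_deriv ?_
    simp only [hsq, Complex.mul_re, Complex.mul_im,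
      Complex.sub_re, Complex.sub_im, Complex.ofReal_re, Complex.ofReal_im]
    ring

/-- The Wronskian of two solutions is constant. -/
theorem wronskian_eq {c x : ℝ} (hx : c ≤ x) {p q : ℝ → ℂ} {u₁ v₁ u₂ v₂ : ℝ → ℂ}
    (hu₁ : AbsolutelyContinuousOnInterval u₁ c x) (hv₁ : AbsolutelyContinuousOnInterval v₁ c x)
    (hu₂ : AbsolutelyContinuousOnInterval u₂ c x) (hv₂ : AbsolutelyContinuousOnInterval v₂ c x)
    (hu₁' : ∀ᵐ t, c < t → HasDerivAt u₁ (p t * v₁ t) t)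
    (hv₁' : ∀ᵐ t, c < t → HasDerivAt v₁ (q t * u₁ t) t)
    (hu₂' : ∀ᵐ t, c < t → HasDerivAt u₂ (p t * v₂ t) t)
    (hv₂' : ∀ᵐ t, c < t → HasDerivAt v₂ (q t * u₂ t) t) :
    u₁ x * v₂ x - u₂ x * v₁ x = u₁ c * v₂ c - u₂ c * v₁ c := by
  obtain ⟨W, hW⟩ := ((hu₁.fun_smul hv₂).fun_sub (hu₂.fun_smul hv₁)).const_of_ae_hasDerivAt_zero (by
    filter_upwards [hu₁', hv₁', hu₂', hv₂', compl_mem_ae_iff.2 (measure_singleton c)] with t h1 h2 h3 h4 hne hmem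
    rw [uIcc_of_le hx] at hmem
    have hct := lt_of_le_of_ne hmem.1 (Ne.symm hne)
    refine (((h1 hct).fun_mul (h4 hct)).fun_sub ((h3 hct).fun_mul (h2 hct))).congr_deriv ?_
    ring)
  simpa using (hW x right_mem_uIcc).trans (hW c left_mem_uIcc).symm

/-- A Levinson-type limit point criterion with a general comparison weight `g`. -/
theorem limitPointAtInfinity_of_weight {a α : ℝ} (ha : 0 < a) {q : ℝ → ℝ}
    (hqloc : LocallyIntegrableOn q (Ioi a)) {c K C : ℝ} (hc : a < c) {g g' G : ℝ → ℝ}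
    (hg0 : ∀ t ≥ c, 0 ≤ g t) (hg1 : ∀ t ≥ c, g t ≤ 1)
    (hg : ∀ t ≥ c, HasDerivAt g (g' t) t) (hg' : ∀ t ≥ c, |g' t| ≤ K * t ^ (-α / 2))
    (hq : ∀ᵐ t, c ≤ t → -C ≤ g t ^ 2 * q t)
    (hG : ∀ t ≥ c, HasDerivAt G (g t * t ^ (-α / 2)) t)
    (hGtop : Filter.Tendsto G Filter.atTop Filter.atTop) :
    LimitPointAtInfinity a α q := by
  intro z
  have hpos : ∀ t ≥ c, 0 < t := fun t ht => ha.trans (hc.trans_le ht)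
  have hs : ContinuousOn (fun t : ℝ => t ^ (-α / 2)) (Ici c) := fun t ht =>
    (Real.continuousAt_rpow_const _ _ (Or.inl (hpos t ht).ne')).continuousWithinAt
  have hs0 : ∀ t ≥ c, 0 ≤ t ^ (-α / 2) := fun t ht => Real.rpow_nonneg (hpos t ht).le _
  have hs2 : ∀ t ≥ c, t ^ (-α) = (t ^ (-α / 2)) ^ 2 := fun t ht => by
    rw [← Real.rpow_natCast, ← Real.rpow_mul (hpos t ht).le]
    norm_num
  have hsol : ∀ u₀ v₀ : ℂ, ∃ u v : ℝ → ℂ, IsSolutionC a α q z u v ∧ u c = u₀ ∧ v c = v₀ ∧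
      (∀ x ≥ c, AbsolutelyContinuousOnInterval u c x) ∧
      (∀ x ≥ c, AbsolutelyContinuousOnInterval v c x) ∧
      (∀ᵐ t, c < t → HasDerivAt u ((((t ^ (-α / 2)) ^ 2 : ℝ) : ℂ) * v t) t) ∧
      (∀ᵐ t, c < t → HasDerivAt v (((q t : ℂ) - z) * u t) t) := by
    intro u₀ v₀
    obtain ⟨u, v, h, h1, h2, h3, h4, h5, h6⟩ := exists_isSolutionC (α := α) ha hqloc z hc u₀ v₀
    refine ⟨u, v, h, h1, h2, h3, h4, ?_, h6⟩
    filter_upwards [h5] with t ht hct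
    rw [← hs2 t hct.le]
    exact ht hct
  by_contra! hcon
  have hL2 : ∀ u v : ℝ → ℂ, IsSolutionC a α q z u v →
      (∀ x ≥ c, AbsolutelyContinuousOnInterval u c x) →
      ∃ D, ∀ x ≥ c, ∫ t in c..x, ‖u t‖ ^ 2 ≤ D := by
    intro u v h hu
    have hfin := hcon u v h c hc
    refine ⟨(∫⁻ t in Ioi c, (‖u t‖₊ : ℝ≥0∞) ^ 2).toReal, fun x hx => ?_⟩
    rw [intervalIntegral.integral_of_le hx, integral_eq_lintegral_of_nonneg_ae
      (ae_of_all _ fun t => sq_nonneg _)]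
    · refine ENNReal.toReal_mono hfin ?_
      refine (lintegral_mono fun t => ?_).trans
        (lintegral_mono_set (Ioc_subset_Ioi_self : Ioc c x ⊆ Ioi c))
      rw [ENNReal.ofReal_pow (norm_nonneg _), ofReal_norm, enorm_eq_nnnorm]
    · have h1 := ((hu x hx).continuousOn.norm.pow 2).mono uIoc_subset_uIcc
      rw [uIoc_of_le hx] at h1
      exact h1.aestronglyMeasurable measurableSet_Ioc
  obtain ⟨u₁, v₁, hS₁, hu₁c, hv₁c, hu₁, hv₁, hu₁', hv₁'⟩ := hsol 1 0
  obtain ⟨u₂, v₂, hS₂, hu₂c, hv₂c, hu₂, hv₂, hu₂', hv₂'⟩ := hsol 0 1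
  obtain ⟨D₁, hD₁⟩ := hL2 u₁ v₁ hS₁ hu₁
  obtain ⟨D₂, hD₂⟩ := hL2 u₂ v₂ hS₂ hu₂
  obtain ⟨B₁, hB₁⟩ := exists_bound_integral_quasiDeriv hs hs0 hg0 hg1 hg hg' hq hu₁ hv₁ hu₁' hv₁' hD₁
  obtain ⟨B₂, hB₂⟩ := exists_bound_integral_quasiDeriv hs hs0 hg0 hg1 hg hg' hq hu₂ hv₂ hu₂' hv₂' hD₂
  have hW : ∀ x ≥ c, u₁ x * v₂ x - u₂ x * v₁ x = 1 := by
    intro x hx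
    rw [wronskian_eq hx (hu₁ x hx) (hv₁ x hx) (hu₂ x hx) (hv₂ x hx) hu₁' hv₁' hu₂' hv₂',
      hu₁c, hv₁c, hu₂c, hv₂c]
    norm_num
  have hpt : ∀ t ≥ c, g t * t ^ (-α / 2) ≤ ‖u₁ t‖ ^ 2 + ‖u₂ t‖ ^ 2 +
      ((g t * t ^ (-α / 2)) ^ 2 * ‖v₁ t‖ ^ 2 + (g t * t ^ (-α / 2)) ^ 2 * ‖v₂ t‖ ^ 2) := by
    intro t ht
    have h1 : 1 ≤ ‖u₁ t‖ * ‖v₂ t‖ + ‖u₂ t‖ * ‖v₁ t‖ := by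
      rw [← norm_mul, ← norm_mul]
      simpa [hW t ht] using norm_sub_le (u₁ t * v₂ t) (u₂ t * v₁ t)
    have h0 : 0 ≤ g t * t ^ (-α / 2) := mul_nonneg (hg0 t ht) (hs0 t ht)
    set h := g t * t ^ (-α / 2)
    nlinarith [mul_le_mul_of_nonneg_left h1 h0, sq_nonneg (‖u₁ t‖ - h * ‖v₂ t‖),
      sq_nonneg (‖u₂ t‖ - h * ‖v₁ t‖), sq_nonneg (‖u₁ t‖), sq_nonneg (‖u₂ t‖),
      sq_nonneg (h * ‖v₁ t‖), sq_nonneg (h * ‖v₂ t‖)]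
  have hbd : ∀ x ≥ c, G x - G c ≤ D₁ + D₂ + (B₁ + B₂) := by
    intro x hx
    have hsub : uIcc c x ⊆ Ici c := by rw [uIcc_of_le hx]; exact Icc_subset_Ici_self
    have hgs : ContinuousOn (fun t => g t * t ^ (-α / 2)) (uIcc c x) := fun t ht =>
      ((hg t (hsub ht)).continuousAt.continuousWithinAt).mul ((hs.mono hsub) t ht)
    have hi := hgs.intervalIntegrable (μ := volume)
    have hi1 := ((hu₁ x hx).continuousOn.norm.pow 2).intervalIntegrable (μ := volume)
    have hi2 := ((hu₂ x hx).continuousOn.norm.pow 2).intervalIntegrable (μ := volume)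
    have hi3 := ((hgs.pow 2).mul ((hv₁ x hx).continuousOn.norm.pow 2)).intervalIntegrable
      (μ := volume)
    have hi4 := ((hgs.pow 2).mul ((hv₂ x hx).continuousOn.norm.pow 2)).intervalIntegrable
      (μ := volume)
    rw [← intervalIntegral.integral_eq_sub_of_hasDerivAt (fun t ht => hG t (hsub ht)) hi]
    refine (intervalIntegral.integral_mono_on hx hi ((hi1.add hi2).add (hi3.add hi4))
      fun t ht => hpt t ht.1).trans ?_
    rw [intervalIntegral.integral_add (hi1.add hi2) (hi3.add hi4),
      intervalIntegral.integral_add hi1 hi2, intervalIntegral.integral_add hi3 hi4]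
    exact add_le_add (add_le_add (hD₁ x hx) (hD₂ x hx)) (add_le_add (hB₁ x hx) (hB₂ x hx))
  obtain ⟨x, hx, hxc⟩ := ((hGtop.eventually_gt_atTop (G c + (D₁ + D₂ + (B₁ + B₂)))).and
    (Filter.eventually_ge_atTop c)).exists
  linarith [hbd x hxc]

theorem tendsto_LnIter_atTop (j : ℕ) : Filter.Tendsto (LnIter j) Filter.atTop Filter.atTop := by
  induction j with
  | zero => exact Filter.tendsto_id
  | succ j ih => exact Real.tendsto_log_atTop.comp ih

theorem hasDerivAt_LnIter_succ {t : ℝ} {j : ℕ} (h : ∀ k ≤ j, 0 < LnIter k t) :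
    HasDerivAt (LnIter (j + 1)) (∏ k ∈ Finset.range (j + 1), LnIter k t)⁻¹ t := by
  induction j with
  | zero => simpa [LnIter] using Real.hasDerivAt_log (h 0 le_rfl).ne'
  | succ j ih =>
    have h1 := (ih fun k hk => h k (hk.trans j.le_succ)).log (h (j + 1) le_rfl).ne'
    rw [Finset.prod_range_succ, mul_inv, ← div_eq_mul_inv]
    exact h1

theorem le_prod_LnIter {t : ℝ} {j : ℕ} (h : ∀ k ≤ j, 1 ≤ LnIter k t) :
    t ≤ ∏ k ∈ Finset.range (j + 1), LnIter k t := by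
  have ht : 1 ≤ t := h 0 (Nat.zero_le j)
  induction j with
  | zero => simp [LnIter]
  | succ j ih =>
    have h1 := ih fun k hk => h k (hk.trans j.le_succ)
    rw [Finset.prod_range_succ]
    nlinarith [h (j + 1) le_rfl]

theorem exists_hasDerivAt_prod_LnIter {t : ℝ} {j : ℕ} (h : ∀ k ≤ j, 1 ≤ LnIter k t) :
    ∃ d, HasDerivAt (fun t => ∏ k ∈ Finset.range (j + 1), LnIter k t) d t ∧ 0 ≤ d ∧
      d ≤ (j + 1) * (∏ k ∈ Finset.range (j + 1), LnIter k t) / t := by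
  have ht : 1 ≤ t := h 0 (Nat.zero_le j)
  have ht0 : t ≠ 0 := by positivity
  induction j with
  | zero => exact ⟨1, by simpa [LnIter] using hasDerivAt_id' t, zero_le_one, by simp [LnIter, ht0]⟩
  | succ j ih =>
    have hj : ∀ k ≤ j, 1 ≤ LnIter k t := fun k hk => h k (hk.trans j.le_succ)
    obtain ⟨d, hd, hd0, hdle⟩ := ih hj
    have hQ := le_prod_LnIter hj
    have hQ' := le_prod_LnIter h
    have hL := hasDerivAt_LnIter_succ fun k hk => zero_lt_one.trans_le (hj k hk)
    have hLpos := h (j + 1) le_rfl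
    have hQ0 : ∏ k ∈ Finset.range (j + 1), LnIter k t ≠ 0 := by linarith
    rw [Finset.prod_range_succ] at hQ' ⊢
    refine ⟨_, (hd.fun_mul hL).congr_of_eventuallyEq
      (Filter.Eventually.of_forall fun x => Finset.prod_range_succ _ _), ?_, ?_⟩
    · rw [mul_inv_cancel₀ hQ0]
      positivity
    · rw [mul_inv_cancel₀ hQ0, le_div_iff₀ (by positivity)]
      rw [le_div_iff₀ (by positivity)] at hdle
      push_cast
      nlinarith [mul_le_mul_of_nonneg_right hdle (zero_le_one.trans hLpos)]

theorem prod_range_succ_LnIter (N : ℕ) (t : ℝ) :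
    ∏ k ∈ Finset.range (N + 1), LnIter k t = t * ∏ k ∈ Finset.Icc 1 N, LnIter k t := by
  induction N with
  | zero => simp [LnIter]
  | succ N ih =>
    rw [Finset.prod_range_succ, ih, Finset.prod_Icc_succ_top (by simp), mul_assoc]

/-- Derivative bound for the comparison weight. -/
theorem exists_hasDerivAt_rpow_div_prod_LnIter {α t : ℝ} (hα : α ≤ 2) {N : ℕ}
    (h : ∀ k ≤ N, 1 ≤ LnIter k t) :
    ∃ d, HasDerivAt (fun t => t ^ (α / 2) / ∏ k ∈ Finset.range (N + 1), LnIter k t) d t ∧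
      |d| ≤ (|α| / 2 + (N + 1)) * t ^ (-α / 2) := by
  have ht : 1 ≤ t := h 0 (Nat.zero_le N)
  have ht0 : 0 < t := by linarith
  obtain ⟨d, hd, hd0, hdle⟩ := exists_hasDerivAt_prod_LnIter h
  have hQ := le_prod_LnIter h
  set Q := ∏ k ∈ Finset.range (N + 1), LnIter k t with hQdef
  have hQ0 : 0 < Q := ht0.trans_le hQ
  refine ⟨_, (Real.hasDerivAt_rpow_const (p := α / 2) (Or.inl ht0.ne')).fun_div hd hQ0.ne', ?_⟩
  simp only [← hQdef]
  have hexp : t ^ (α / 2) = t ^ (α / 2 - 1) * t := by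
    rw [← Real.rpow_add_one ht0.ne']; ring_nf
  have hle : t ^ (α / 2 - 1) ≤ t ^ (-α / 2) * t := by
    rw [← Real.rpow_add_one ht0.ne']
    exact Real.rpow_le_rpow_of_exponent_le ht (by linarith)
  have hr : 0 < t ^ (α / 2 - 1) := Real.rpow_pos_of_pos ht0 _
  have hr' : 0 < t ^ (-α / 2) := Real.rpow_pos_of_pos ht0 _
  rw [abs_div, abs_of_pos (by positivity : 0 < Q ^ 2), div_le_iff₀ (by positivity)]
  have hdt : t * d ≤ (N + 1) * Q := by
    rw [le_div_iff₀ ht0] at hdle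
    linarith
  calc |α / 2 * t ^ (α / 2 - 1) * Q - t ^ (α / 2) * d|
      ≤ |α / 2 * t ^ (α / 2 - 1) * Q| + |t ^ (α / 2) * d| := abs_sub _ _
    _ = t ^ (α / 2 - 1) * (|α| / 2 * Q + t * d) := by
        rw [hexp, abs_mul, abs_mul, abs_div, abs_of_pos hr, abs_of_pos hQ0,
          abs_of_nonneg (by positivity : 0 ≤ t ^ (α / 2 - 1) * t * d), abs_two]
        ring
    _ ≤ (t ^ (-α / 2) * t) * (|α| / 2 * Q + (N + 1) * Q) := by gcongr
    _ = (|α| / 2 + (N + 1)) * t ^ (-α / 2) * (t * Q) := by ring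
    _ ≤ (|α| / 2 + (N + 1)) * t ^ (-α / 2) * Q ^ 2 := by
        rw [sq]; gcongr

theorem statement14 (a : ℝ) (ha : 0 < a) (α : ℝ) (hα : α ≤ 2)
    (q : ℝ → ℝ) (hq_meas : Measurable q)
    (hq_loc : LocallyIntegrableOn q (Ioi a))
    (C : ℝ) (hC : 0 < C) (N : ℕ) (hN : 1 ≤ N) (R : ℝ) (hR : a < R)
    (hpos : ∀ x ∈ Ici R, ∀ j ∈ Finset.Icc 1 N, 0 < LnIter j x)
    (hq : ∀ᵐ x : ℝ, x ∈ Ici R →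
      -C * x ^ (2 - α) * ∏ k ∈ Finset.Icc 1 N, (LnIter k x) ^ 2 ≤ q x) :
    LimitPointAtInfinity a α q := by
  have hev : ∀ᶠ c : ℝ in Filter.atTop, ∀ t ≥ c, ∀ k ∈ Finset.range (N + 1), 1 ≤ LnIter k t :=
    Filter.eventually_forall_ge_atTop.2 ((Filter.eventually_all_finset _).2
      fun k _ => (tendsto_LnIter_atTop k).eventually_ge_atTop 1)
  obtain ⟨c, hc, hRc⟩ := (hev.and (Filter.eventually_ge_atTop R)).exists
  have hL : ∀ t ≥ c, ∀ k ≤ N, 1 ≤ LnIter k t := fun t ht k hk =>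
    hc t ht k (Finset.mem_range_succ_iff.2 hk)
  have ht1 : ∀ t ≥ c, 1 ≤ t := fun t ht => hL t ht 0 (Nat.zero_le N)
  have hQ : ∀ t ≥ c, t ≤ ∏ k ∈ Finset.range (N + 1), LnIter k t := fun t ht =>
    le_prod_LnIter (hL t ht)
  have hd : ∀ t ≥ c, _ := fun t ht => exists_hasDerivAt_rpow_div_prod_LnIter hα (hL t ht)
  refine limitPointAtInfinity_of_weight (c := c) (C := C) (K := |α| / 2 + (N + 1))
    (g := fun t => t ^ (α / 2) / ∏ k ∈ Finset.range (N + 1), LnIter k t)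
    (g' := deriv fun t => t ^ (α / 2) / ∏ k ∈ Finset.range (N + 1), LnIter k t)
    (G := LnIter (N + 1)) ha hq_loc (hR.trans_le hRc) ?_ ?_ ?_ ?_ ?_ ?_ (tendsto_LnIter_atTop _)
  · intro t ht
    have := ht1 t ht
    have := hQ t ht
    exact div_nonneg (Real.rpow_nonneg (by linarith) _) (by linarith)
  · intro t ht
    have h1 := ht1 t ht
    have h2 := hQ t ht
    refine div_le_one_of_le₀ (le_trans ?_ h2) (by linarith)
    calc t ^ (α / 2) ≤ t ^ (1 : ℝ) := Real.rpow_le_rpow_of_exponent_le h1 (by linarith)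
      _ = t := Real.rpow_one t
  · intro t ht
    obtain ⟨d, h1, -⟩ := hd t ht
    exact h1.differentiableAt.hasDerivAt
  · intro t ht
    obtain ⟨d, h1, h2⟩ := hd t ht
    rwa [h1.deriv]
  · filter_upwards [hq] with t htq ht
    have h := htq (hRc.trans ht)
    have h1 := ht1 t ht
    have ht0 : 0 < t := by linarith
    have h2 := hQ t ht
    rw [prod_range_succ_LnIter] at h2 ⊢
    rw [Finset.prod_pow] at h
    set P := ∏ k ∈ Finset.Icc 1 N, LnIter k t
    have hP : 0 < P := pos_of_mul_pos_right (ht0.trans_le h2) ht0.le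
    have hpow : (t ^ (α / 2)) ^ 2 * t ^ (2 - α) = t ^ 2 := by
      rw [← Real.rpow_natCast (t ^ (α / 2)), ← Real.rpow_mul ht0.le, ← Real.rpow_add ht0,
        ← Real.rpow_natCast t]
      congr 1
      push_cast
      ring
    calc -C = (t ^ (α / 2) / (t * P)) ^ 2 * (-C * t ^ (2 - α) * P ^ 2) := by
          have : (t ^ (α / 2) / (t * P)) ^ 2 * (-C * t ^ (2 - α) * P ^ 2)
              = -C * ((t ^ (α / 2)) ^ 2 * t ^ (2 - α)) * P ^ 2 / (t * P) ^ 2 := by ring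
          rw [this, hpow]
          field_simp
      _ ≤ _ := mul_le_mul_of_nonneg_left h (sq_nonneg _)
  · intro t ht
    have ht0 : 0 < t := zero_lt_one.trans_le (ht1 t ht)
    refine (hasDerivAt_LnIter_succ fun k hk => zero_lt_one.trans_le (hL t ht k hk)).congr_deriv ?_
    rw [div_mul_eq_mul_div, ← Real.rpow_add ht0, neg_div, add_neg_cancel, Real.rpow_zero, one_div]
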